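/- Let ρ : Q₈ → GL₄(𝔽₂) be an injective group homomorphism, let z be the unique element of order 2 of Q₈, and let G = H ⋊_ρ Q₈ be the semidirect product where H = (ℤ/2)⁴ (so |G| = 128). Let λ : H → ℂˣ be a group homomorphism whose kernel is a subgroup of index 2 in H not containing the image of ρ(z) − 1, and suppose that for every x ∈ Q₈ with x ≠ 1 the subgroup [H, x] (generated by the commutators [h, x], h ∈ H, inside G) is not contained in ker λ. Then the induced character χ = Ind_H^G λ is irreducible of degree 8 and satisfies Σ_{g ∈ G} χ(g²) = |G|, i.e., its Frobenius–Schur indicator is ν₂(χ) = +1. -/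

import Mathlib

instance semidirectProductFintype {N G : Type*} [Group N] [Group G] (φ : G →* MulAut N)
    [Fintype N] [Fintype G] : Fintype (N ⋊[φ] G) :=
  Fintype.ofEquiv (N × G)
    { toFun := fun p => ⟨p.1, p.2⟩
      invFun := fun s => (s.left, s.right)
      left_inv := fun _ => rfl
      right_inv := fun _ => rfl }

open Classical in
/-- The induced character `Ind_H^G λ` of a degree-one character `λ : H → ℂˣ`,
given by `(Ind_H^G λ)(g) = |H|⁻¹ · Σ_{t ∈ G, t⁻¹gt ∈ H} λ(t⁻¹gt)`. -/
noncomputable def inducedChar {G : Type*} [Group G] [Fintype G] (H : Subgroup G)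
    (lam : H →* ℂˣ) : G → ℂ := fun g =>
  (Nat.card H : ℂ)⁻¹ * ∑ t : G, if h : t⁻¹ * g * t ∈ H then (lam ⟨t⁻¹ * g * t, h⟩ : ℂ) else 0

section Semidirect

variable {N Q : Type*} [CommGroup N] [Group Q]

/-- The conjugate `n ↦ μ (y⁻¹ n y)` of a degree-one character `μ` of `N` by `y ∈ Q`. -/
def conjChar (φ : Q →* MulAut N) (μ : N →* ℂˣ) (y : Q) : N →* ℂˣ :=
  μ.comp (φ y⁻¹).toMonoidHom

@[simp]
lemma conjChar_apply (φ : Q →* MulAut N) (μ : N →* ℂˣ) (y : Q) (n : N) :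
    conjChar φ μ y n = μ (φ y⁻¹ n) := rfl

/-- The representation of `N ⋊[φ] Q` induced from `μ : N → ℂˣ`, realised on functions on `Q`. -/
def monomialRep (φ : Q →* MulAut N) (μ : N →* ℂˣ) :
    Representation ℂ (N ⋊[φ] Q) (Q → ℂ) where
  toFun g :=
    { toFun := fun f y => (μ (φ y⁻¹ g.left) : ℂ) * f (g.right⁻¹ * y)
      map_add' := fun f f' => by ext y; simp [mul_add]
      map_smul' := fun c f => by ext y; simp [mul_left_comm] }
  map_one' := by ext; simp
  map_mul' g h := by
    refine LinearMap.ext fun f => funext fun y => ?_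
    have hy : φ y⁻¹ (φ g.right h.left) = φ (g.right⁻¹ * y)⁻¹ h.left := by
      rw [← MulAut.mul_apply, ← map_mul, mul_inv_rev, inv_inv]
    simp [-mul_inv_rev, -map_inv, hy, mul_inv_rev g.right, mul_assoc]

lemma trace_monomialRep [Fintype Q] [DecidableEq Q] (φ : Q →* MulAut N) (μ : N →* ℂˣ)
    (g : N ⋊[φ] Q) :
    LinearMap.trace ℂ (Q → ℂ) (monomialRep φ μ g) =
      if g.right = 1 then ∑ y, (conjChar φ μ y g.left : ℂ) else 0 := by
  rw [LinearMap.trace_eq_matrix_trace ℂ (Pi.basisFun ℂ Q), Matrix.trace]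
  simp only [Matrix.diag_apply, LinearMap.toMatrix_apply, Pi.basisFun_repr, Pi.basisFun_apply,
    monomialRep, MonoidHom.coe_mk, OneHom.coe_mk, LinearMap.coe_mk, AddHom.coe_mk,
    Pi.single_apply, mul_eq_right, inv_eq_one, mul_ite, mul_one, mul_zero, conjChar_apply]
  split_ifs <;> simp

lemma sum_semidirectProduct [Fintype N] [Fintype Q] (φ : Q →* MulAut N) (f : N ⋊[φ] Q → ℂ) :
    ∑ g, f g = ∑ n : N, ∑ y : Q, f ⟨n, y⟩ := by
  rw [← Fintype.sum_prod_type']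
  exact Fintype.sum_equiv SemidirectProduct.equivProd _ _ fun _ => rfl

lemma inducedChar_range_inl [Fintype N] [Fintype Q] [DecidableEq Q] (φ : Q →* MulAut N)
    (lam : (SemidirectProduct.inl (φ := φ)).range →* ℂˣ) (g : N ⋊[φ] Q) :
    inducedChar (SemidirectProduct.inl (φ := φ)).range lam g =
      if g.right = 1 then
        ∑ y, (conjChar φ (lam.comp SemidirectProduct.inl.rangeRestrict) y g.left : ℂ) else 0 := by
  have hcard : Nat.card (SemidirectProduct.inl (φ := φ)).range = Fintype.card N := by
    rw [← Nat.card_eq_fintype_card]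
    exact (Nat.card_congr
      (MonoidHom.ofInjective (SemidirectProduct.inl_injective (φ := φ))).toEquiv).symm
  have hmem (t : N ⋊[φ] Q) :
      t⁻¹ * g * t ∈ (SemidirectProduct.inl (φ := φ)).range ↔ g.right = 1 := by
    rw [SemidirectProduct.range_inl_eq_ker_rightHom, MonoidHom.mem_ker]
    simp [mul_assoc, inv_mul_eq_one]
  rw [inducedChar, sum_semidirectProduct, hcard]
  split_ifs with hg
  · have hterm (n : N) (y : Q) (h) :
        lam ⟨(⟨n, y⟩ : N ⋊[φ] Q)⁻¹ * g * ⟨n, y⟩, h⟩ =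
          conjChar φ (lam.comp SemidirectProduct.inl.rangeRestrict) y g.left := by
      refine congrArg lam (Subtype.ext (SemidirectProduct.ext ?_ ?_))
      · simp [hg, mul_right_comm]
      · simp [hg]
    simp only [hmem, hg, hterm, dite_true]
    simp
  · simp only [hmem, hg, dite_false, Finset.sum_const_zero, mul_zero]

lemma sum_monoidHom_units [Fintype N] (f : N →* ℂˣ) [Decidable (f = 1)] :
    ∑ n, (f n : ℂ) = if f = 1 then (Fintype.card N : ℂ) else 0 := by
  classical
  have h := sum_hom_units ((Units.coeHom ℂ).comp f)
  have hf : (Units.coeHom ℂ).comp f = 1 ↔ f = 1 := by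
    simp [MonoidHom.ext_iff]
  simpa [hf] using h

lemma conjChar_injective (φ : Q →* MulAut N) (μ : N →* ℂˣ)
    (hμ : ∀ x : Q, x ≠ 1 → ∃ n, μ (φ x n) ≠ μ n) : Function.Injective (conjChar φ μ) := by
  intro x y hxy
  by_contra hne
  obtain ⟨n, hn⟩ := hμ (x⁻¹ * y) (by simpa [inv_mul_eq_one] using hne)
  apply hn
  simpa only [conjChar_apply, ← MulAut.mul_apply, ← map_mul, inv_mul_cancel, map_one,
    MulAut.one_apply] using DFunLike.congr_fun hxy (φ y n)

/-- The induced representation is irreducible when `μ` has trivial stabiliser in `Q`. -/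
lemma simple_monomialRep {N Q : Type} [CommGroup N] [Group Q] [Fintype N] [Fintype Q]
    (φ : Q →* MulAut N) (μ : N →* ℂˣ)
    (hμ : ∀ x : Q, x ≠ 1 → ∃ n, μ (φ x n) ≠ μ n) :
    CategoryTheory.Simple (FDRep.of (monomialRep φ μ)) := by
  classical
  rw [FDRep.simple_iff_char_is_norm_one]
  have hchar (g : N ⋊[φ] Q) : (FDRep.of (monomialRep φ μ)).character g =
      if g.right = 1 then ∑ y, (conjChar φ μ y g.left : ℂ) else 0 :=
    trace_monomialRep φ μ g
  have hmul (n : N) (x y : Q) : (conjChar φ μ x n : ℂ) * (conjChar φ μ y n⁻¹ : ℂ) =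
      ((conjChar φ μ x / conjChar φ μ y) n : ℂˣ) := by
    rw [map_inv, MonoidHom.div_apply, div_eq_mul_inv, Units.val_mul]
  have hdiv (x y : Q) : conjChar φ μ x / conjChar φ μ y = 1 ↔ x = y :=
    div_eq_one.trans (conjChar_injective φ μ hμ).eq_iff
  have hinv (n : N) : (⟨n, 1⟩ : N ⋊[φ] Q)⁻¹.left = n⁻¹ := by
    rw [SemidirectProduct.inv_left]
    simp
  calc _ = ∑ n : N, ∑ x : Q, ∑ y : Q, ((conjChar φ μ x / conjChar φ μ y) n : ℂ) := by
        rw [sum_semidirectProduct]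
        refine Finset.sum_congr rfl fun n _ => ?_
        rw [Finset.sum_eq_single 1]
        · simp only [hchar, hinv, SemidirectProduct.inv_right, inv_one, if_true,
            Finset.sum_mul_sum, hmul]
        · intro y _ hy
          simp [hchar, hy]
        · simp
    _ = ∑ x : Q, ∑ y : Q, ∑ n : N, ((conjChar φ μ x / conjChar φ μ y) n : ℂ) := by
        rw [Finset.sum_comm]
        exact Finset.sum_congr rfl fun x _ => Finset.sum_comm
    _ = _ := by
        simp_rw [sum_monoidHom_units, hdiv]
        rw [SemidirectProduct.card]
        simp [mul_comm]

/-- If `z` is central, the only involution of `Q`, and `μ (n · ᶻn)` is not identically `1`, then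
the squares of elements outside `N` contribute nothing to `∑ (Ind μ)(g²)`. -/
lemma sum_inducedChar_sq [Fintype N] [Fintype Q] (φ : Q →* MulAut N)
    (lam : (SemidirectProduct.inl (φ := φ)).range →* ℂˣ) (z : Q)
    (hz : ∀ x, z * x = x * z) (hsq : ∀ x : Q, x ^ 2 = 1 ↔ x = 1 ∨ x = z) (hz1 : z ≠ 1)
    (hN : ∀ n : N, n ^ 2 = 1)
    (hlam : ∃ n : N, lam (SemidirectProduct.inl.rangeRestrict (n * φ z n)) ≠ 1) :
    ∑ g : N ⋊[φ] Q, inducedChar (SemidirectProduct.inl (φ := φ)).range lam (g ^ 2) =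
      Fintype.card N * Fintype.card Q := by
  classical
  set μ := lam.comp SemidirectProduct.inl.rangeRestrict
  have hone (n : N) : ((⟨n, 1⟩ : N ⋊[φ] Q) ^ 2).left = 1 := by
    rw [← hN n]; simp [sq]
  have hz_sum (y : Q) :
      ∑ n : N, (conjChar φ μ y ((⟨n, z⟩ : N ⋊[φ] Q) ^ 2).left : ℂ) = 0 := by
    let f : N →* ℂˣ := conjChar φ μ y * (conjChar φ μ y).comp (φ z).toMonoidHom
    have hf : f ≠ 1 := by
      intro h
      obtain ⟨n, hn⟩ := hlam
      have hyy : φ y⁻¹ (φ y n) = n := by simp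
      have hyz : φ y⁻¹ (φ z (φ y n)) = φ z n := by
        simp only [← MulAut.mul_apply, ← map_mul, hz y, inv_mul_cancel_left]
      have := DFunLike.congr_fun h (φ y n)
      apply hn
      simpa [f, μ, hyz, -map_inv, hyy] using this
    have := sum_monoidHom_units f
    rw [if_neg hf] at this
    simpa [f, sq] using this
  have hfiber (n : N) :
      ∑ y : Q, inducedChar (SemidirectProduct.inl (φ := φ)).range lam (⟨n, y⟩ ^ 2) =
        Fintype.card Q + ∑ y : Q, (conjChar φ μ y ((⟨n, z⟩ : N ⋊[φ] Q) ^ 2).left : ℂ) := by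
    have hright (y : Q) : ((⟨n, y⟩ : N ⋊[φ] Q) ^ 2).right = y ^ 2 := by simp [sq]
    simp_rw [inducedChar_range_inl, hright, hsq]
    rw [← Finset.sum_subset (Finset.subset_univ {1, z}), Finset.sum_pair hz1.symm]
    · simp only [true_or, or_true, if_true, hone, map_one, Units.val_one, Finset.sum_const,
        Finset.card_univ, nsmul_one, μ]
    · intro y _ hy
      simp_all
  rw [sum_semidirectProduct]
  simp_rw [hfiber, Finset.sum_add_distrib]
  rw [Finset.sum_comm]
  simp only [hz_sum, Finset.sum_const_zero, add_zero, Finset.sum_const, Finset.card_univ,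
    nsmul_eq_mul]

end Semidirect

lemma QuaternionGroup.eq_a_two_of_orderOf {z : QuaternionGroup 2} (hz : orderOf z = 2) :
    z = .a 2 := by
  have h1 : z ^ 2 = 1 := by
    simpa only [hz] using pow_orderOf_eq_one z
  have h2 : z ≠ 1 := by rintro rfl; simp at hz
  clear hz
  revert z
  decide

/-- Let `ρ : Q₈ → GL₄(𝔽₂)` be injective, `z` the unique element of order 2 of `Q₈`, and
`G = H ⋊_ρ Q₈` the semidirect product with `H = (ℤ/2)⁴` (so `|G| = 128`).  If `λ : H → ℂˣ`
has kernel of index 2 not containing the image of `ρ(z) - 1`, and for every `x ≠ 1` in `Q₈`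
the commutator subgroup `[H, x]` is not contained in `ker λ`, then `χ = Ind_H^G λ` is an
irreducible character of degree 8 with `Σ_g χ(g²) = |G|`, i.e. `ν₂(χ) = +1`. -/
theorem induced_char_irreducible_plus_indicator
    (ρ : QuaternionGroup 2 →* GL (Fin 4) (ZMod 2)) (hρ : Function.Injective ρ)
    (z : QuaternionGroup 2) (hz : orderOf z = 2)
    (φ : QuaternionGroup 2 →* MulAut (Multiplicative (Fin 4 → ZMod 2)))
    (hφ : ∀ (x : QuaternionGroup 2) (v : Fin 4 → ZMod 2),
      (φ x (Multiplicative.ofAdd v)).toAdd = (ρ x : Matrix (Fin 4) (Fin 4) (ZMod 2)).mulVec v)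
    (lam : (SemidirectProduct.inl (φ := φ)).range →* ℂˣ)
    (hker : lam.ker.index = 2)
    (hzker : ∃ v : Fin 4 → ZMod 2,
      lam ⟨SemidirectProduct.inl (Multiplicative.ofAdd
        ((ρ z : Matrix (Fin 4) (Fin 4) (ZMod 2)).mulVec v - v)), ⟨_, rfl⟩⟩ ≠ 1)
    (hcomm : ∀ x : QuaternionGroup 2, x ≠ 1 → ∃ h : Multiplicative (Fin 4 → ZMod 2),
      lam ⟨(SemidirectProduct.inl h)⁻¹ * (SemidirectProduct.inr x)⁻¹ *
            SemidirectProduct.inl h * SemidirectProduct.inr x,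
        by rw [SemidirectProduct.range_inl_eq_ker_rightHom, MonoidHom.mem_ker]; simp⟩ ≠ 1) :
    Fintype.card (Multiplicative (Fin 4 → ZMod 2) ⋊[φ] QuaternionGroup 2) = 128 ∧
    (∃ V : FDRep ℂ (Multiplicative (Fin 4 → ZMod 2) ⋊[φ] QuaternionGroup 2),
      CategoryTheory.Simple V ∧
      V.character = inducedChar (SemidirectProduct.inl (φ := φ)).range lam) ∧
    inducedChar (SemidirectProduct.inl (φ := φ)).range lam 1 = 8 ∧
    ∑ g : Multiplicative (Fin 4 → ZMod 2) ⋊[φ] QuaternionGroup 2,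
        inducedChar (SemidirectProduct.inl (φ := φ)).range lam (g ^ 2) =
      (Fintype.card (Multiplicative (Fin 4 → ZMod 2) ⋊[φ] QuaternionGroup 2) : ℂ) := by
  have h2 (n : Multiplicative (Fin 4 → ZMod 2)) : n ^ 2 = 1 :=
    Multiplicative.toAdd.injective (funext fun i => by
      simpa using CharTwo.two_nsmul (n.toAdd i))
  have hcard : Fintype.card (Multiplicative (Fin 4 → ZMod 2) ⋊[φ] QuaternionGroup 2) = 128 := by
    rw [← Nat.card_eq_fintype_card, SemidirectProduct.card]
    simp [Nat.card_eq_fintype_card, QuaternionGroup.card]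
  have hQ : Fintype.card (QuaternionGroup 2) = 8 := by simp [QuaternionGroup.card]
  set μ := lam.comp SemidirectProduct.inl.rangeRestrict
  refine ⟨hcard, ⟨FDRep.of (monomialRep φ μ), simple_monomialRep φ μ fun x hx => ?_, ?_⟩,
    ?_, ?_⟩
  · obtain ⟨n, hn⟩ := hcomm x⁻¹ (inv_ne_one.mpr hx)
    refine ⟨n, fun h => hn ?_⟩
    have h1 : μ (n⁻¹ * φ x n) = 1 := by rw [map_mul, h, map_inv, inv_mul_cancel]
    rw [← h1]
    exact congrArg lam (Subtype.ext (SemidirectProduct.ext (by simp) (by simp)))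
  · funext g
    rw [inducedChar_range_inl]
    exact trace_monomialRep φ μ g
  · simp [inducedChar_range_inl, hQ]
  · obtain rfl := QuaternionGroup.eq_a_two_of_orderOf hz
    rw [sum_inducedChar_sq φ lam (.a 2) (by decide) (by decide) (by decide) h2, hcard, hQ]
    · simp
      norm_num
    · obtain ⟨v, hv⟩ := hzker
      refine ⟨.ofAdd v, fun h => hv ?_⟩
      rw [← h]
      refine congrArg lam (Subtype.ext (congrArg SemidirectProduct.inl ?_))
      apply Multiplicative.toAdd.injective
      rw [toAdd_mul, hφ, toAdd_ofAdd, toAdd_ofAdd, CharTwo.sub_eq_add, add_comm]
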